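/- Let m be a positive integer, let δ > 0, and for each lattice index j ∈ ℤ^m let C_j = ∏_{i=1}^m [j_i δ, (j_i+1)δ) be the corresponding half-open grid cube in ℝ^m. Let X_shape ⊆ ℝ^m be a nonempty finite set, let J ⊆ ℤ^m be a nonempty finite set of lattice indices, and let f : J → ℝ^m satisfy f(j) ∈ C_j for every j ∈ J; set X* = { f(j) : j ∈ J }. Assume: (i) for every j ∈ J, the cube C_j contains at least one point of X_shape, and (ii) for every x ∈ X_shape, the unique lattice index j with x ∈ C_j belongs to J. Then, viewing X_shape and X* as nonempty compact metric spaces with the subspace metric, the Gromov–Hausdorff distance satisfies d_GH(X_shape, X*) ≤ √m · δ. -/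

import Mathlib

open scoped BigOperators

/-- The half-open grid cube of side length `δ` indexed by `j ∈ ℤ^m` in Euclidean space `ℝ^m`:
`C_j = ∏_{i=1}^m [j_i δ, (j_i + 1) δ)`. -/
def gridCube (m : ℕ) (δ : ℝ) (j : Fin m → ℤ) : Set (EuclideanSpace ℝ (Fin m)) :=
  {x | ∀ i : Fin m, (j i : ℝ) * δ ≤ x i ∧ x i < ((j i : ℝ) + 1) * δ}

/-- The Euclidean diameter of a grid cube of side `δ` is at most `√m · δ`. -/
theorem dist_le_of_mem_gridCube {m : ℕ} {δ : ℝ} (hδ : 0 ≤ δ) {j : Fin m → ℤ}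
    {x y : EuclideanSpace ℝ (Fin m)} (hx : x ∈ gridCube m δ j) (hy : y ∈ gridCube m δ j) :
    dist x y ≤ Real.sqrt m * δ := by
  have h : ∑ i, dist (x i) (y i) ^ 2 ≤ m * δ ^ 2 := by
    calc ∑ i, dist (x i) (y i) ^ 2 ≤ ∑ _i : Fin m, δ ^ 2 := by
          refine Finset.sum_le_sum fun i _ => ?_
          refine pow_le_pow_left₀ dist_nonneg ?_ 2
          rw [Real.dist_eq, abs_le]
          constructor <;> linarith [(hx i).1, (hx i).2, (hy i).1, (hy i).2]
      _ = m * δ ^ 2 := by simp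
  rw [EuclideanSpace.dist_eq]
  calc √(∑ i, dist (x i) (y i) ^ 2) ≤ √(m * δ ^ 2) := Real.sqrt_le_sqrt h
    _ = √m * δ := by rw [Real.sqrt_mul (Nat.cast_nonneg m), Real.sqrt_sq hδ]

/-- The grid cubes of side `δ > 0` cover `ℝ^m`. -/
theorem exists_mem_gridCube {m : ℕ} {δ : ℝ} (hδ : 0 < δ) (x : EuclideanSpace ℝ (Fin m)) :
    ∃ j, x ∈ gridCube m δ j :=
  ⟨fun i => ⌊x i / δ⌋, fun _ =>
    ⟨(le_div_iff₀ hδ).1 (Int.floor_le _), (div_lt_iff₀ hδ).1 (Int.lt_floor_add_one _)⟩⟩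

/-- If `X* = f '' J` is a set of representative points, one from each selected cube `C_j`
(`j ∈ J`), every selected cube contains a shape point, and every shape point lies in a
selected cube, then the Gromov–Hausdorff distance between `X_shape` and `X*` (each viewed as
a nonempty compact metric space with the subspace metric) is at most `√m · δ`. -/
theorem ghDist_shape_rcla_le (m : ℕ) (hm : 0 < m) (δ : ℝ) (hδ : 0 < δ)
    (Xshape : Set (EuclideanSpace ℝ (Fin m))) (hXne : Xshape.Nonempty) (hXfin : Xshape.Finite)
    (J : Set (Fin m → ℤ)) (hJne : J.Nonempty) (hJfin : J.Finite)
    (f : (Fin m → ℤ) → EuclideanSpace ℝ (Fin m))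
    (hf : ∀ j ∈ J, f j ∈ gridCube m δ j)
    (h1 : ∀ j ∈ J, ∃ x ∈ Xshape, x ∈ gridCube m δ j)
    (h2 : ∀ x ∈ Xshape, ∀ j : Fin m → ℤ, x ∈ gridCube m δ j → j ∈ J) :
    letI : Nonempty ↥Xshape := hXne.to_subtype
    letI : Nonempty ↥(f '' J) := (hJne.image f).to_subtype
    letI : CompactSpace ↥Xshape := isCompact_iff_compactSpace.mp hXfin.isCompact
    letI : CompactSpace ↥(f '' J) := isCompact_iff_compactSpace.mp (hJfin.image f).isCompact
    GromovHausdorff.ghDist ↥Xshape ↥(f '' J) ≤ Real.sqrt m * δ := by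
  let : Nonempty ↥Xshape := hXne.to_subtype
  let : Nonempty ↥(f '' J) := (hJne.image f).to_subtype
  let : CompactSpace ↥Xshape := isCompact_iff_compactSpace.mp hXfin.isCompact
  let : CompactSpace ↥(f '' J) := isCompact_iff_compactSpace.mp (hJfin.image f).isCompact
  refine (GromovHausdorff.ghDist_le_hausdorffDist (isometry_subtype_coe (s := Xshape))
    (isometry_subtype_coe (s := f '' J))).trans ?_
  rw [Subtype.range_coe, Subtype.range_coe]
  refine Metric.hausdorffDist_le_of_mem_dist (by positivity) ?_ ?_
  · intro x hx
    obtain ⟨j, hj⟩ := exists_mem_gridCube hδ x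
    have hjJ := h2 x hx j hj
    exact ⟨f j, Set.mem_image_of_mem f hjJ, dist_le_of_mem_gridCube hδ.le hj (hf j hjJ)⟩
  · rintro _ ⟨j, hj, rfl⟩
    obtain ⟨x, hx, hxj⟩ := h1 j hj
    exact ⟨x, hx, dist_le_of_mem_gridCube hδ.le (hf j hj) hxj⟩
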